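/- arXiv:1812.04289 — 3 statements merged into one kernel-verified Lean document; each statement's English description precedes it below -/
import Mathlib

section
/- Let τ ∈ (2,3) and K > 0. There exists a constant C' > 0, depending only on τ and K, such that the following holds for every n: if G is any simple graph on n vertices whose degree sequence d satisfies 1 − F_n(j) ≤ K j^{1−τ} for every integer 1 ≤ j ≤ d_max, then for every vertex v of G, Σ_{u : u ∼ v} deg(u) ≤ C' · n^{(2τ−3)/(τ−1)²}. Moreover (2τ−3)/(τ−1)² < 1 for τ ∈ (2,3), so the number of 2-paths starting from any specified vertex is o(n). -/
open Filter MeasureTheory Real Set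
open scoped Topology ENNReal NNReal Classical

noncomputable section

/-- Degree of vertex `i` in the simple graph `G`. -/
def degreeOf {n : ℕ} (G : SimpleGraph (Fin n)) (i : Fin n) : ℕ :=
  letI := Classical.decRel G.Adj
  G.degree i

/-- `G` has degree sequence `d`. -/
def hasDegSeq {n : ℕ} (G : SimpleGraph (Fin n)) (d : Fin n → ℕ) : Prop :=
  ∀ i, degreeOf G i = d i

/-- Probability of the event `E` under the uniform distribution on the set of simple
graphs with degree sequence `d`. -/
def Pr {n : ℕ} (d : Fin n → ℕ) (E : SimpleGraph (Fin n) → Prop) : ℝ :=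
  (Nat.card {G : SimpleGraph (Fin n) // hasDegSeq G d ∧ E G} : ℝ) /
    (Nat.card {G : SimpleGraph (Fin n) // hasDegSeq G d} : ℝ)

/-- Expectation of `X` under the uniform distribution on graphs with degree sequence `d`. -/
def Expec {n : ℕ} (d : Fin n → ℕ) (X : SimpleGraph (Fin n) → ℝ) : ℝ :=
  (∑ᶠ G ∈ {G : SimpleGraph (Fin n) | hasDegSeq G d}, X G) /
    (Nat.card {G : SimpleGraph (Fin n) // hasDegSeq G d} : ℝ)

/-- Variance of `X` under the uniform distribution on graphs with degree sequence `d`. -/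
def Variance {n : ℕ} (d : Fin n → ℕ) (X : SimpleGraph (Fin n) → ℝ) : ℝ :=
  Expec d fun G => (X G - Expec d X) ^ 2

/-- The number of triangles of `G`. -/
def triangleCount {n : ℕ} (G : SimpleGraph (Fin n)) : ℕ :=
  letI := Classical.decRel G.Adj
  (G.cliqueFinset 3).card

/-- Empirical degree distribution function `F_n`. -/
def Fn (n : ℕ) (d : Fin n → ℕ) (j : ℕ) : ℝ :=
  (Nat.card {i : Fin n // d i ≤ j} : ℝ) / n

/-- Maximum degree. -/
def dmax (n : ℕ) (d : Fin n → ℕ) : ℕ := Finset.univ.sup d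

/-- `μ = E[D]` where `D` is integer valued with `P(D > j) = C j^{1-τ}` for `j ≥ 1`
(and `P(D > 0) = 1`), via the tail-sum formula. -/
def muD (C τ : ℝ) : ℝ := 1 + C * ∑' j : ℕ, (j : ℝ) ^ (1 - τ)

/-- Assumption (i): power-law upper bound on the empirical tails. -/
def AssumpI (τ K : ℝ) (d : (n : ℕ) → Fin n → ℕ) : Prop :=
  ∀ n : ℕ, ∀ j : ℕ, 1 ≤ j → j ≤ dmax n (d n) →
    1 - Fn n (d n) j ≤ K * (j : ℝ) ^ (1 - τ)

/-- Assumption 1(ii): `1 - F_n(j) = C j^{1-τ}(1+o(1))` uniformly for `j = O(√n)`. -/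
def AssumpII (τ C : ℝ) (d : (n : ℕ) → Fin n → ℕ) : Prop :=
  ∀ M > (0:ℝ), ∀ ε > (0:ℝ), ∃ N : ℕ, ∀ n ≥ N, ∀ j : ℕ, 1 ≤ j →
    (j : ℝ) ≤ M * Real.sqrt n →
    |(1 - Fn n (d n) j) - C * (j : ℝ) ^ (1 - τ)| ≤ ε * (C * (j : ℝ) ^ (1 - τ))

/-- Assumption 2(ii)': `1 - F_n(j) = C j^{1-τ}(1+o(1))` uniformly for
`j ≤ c n^{1/(τ-1)}/log n`. -/
def AssumpII' (τ C c : ℝ) (d : (n : ℕ) → Fin n → ℕ) : Prop :=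
  ∀ ε > (0:ℝ), ∃ N : ℕ, ∀ n ≥ N, ∀ j : ℕ, 1 ≤ j →
    (j : ℝ) ≤ c * (n : ℝ) ^ (1/(τ-1)) / Real.log n →
    |(1 - Fn n (d n) j) - C * (j : ℝ) ^ (1 - τ)| ≤ ε * (C * (j : ℝ) ^ (1 - τ))

/-- Number of vertices of degree `k`. -/
def Nk {n : ℕ} (d : Fin n → ℕ) (k : ℕ) : ℕ := Nat.card {i : Fin n // d i = k}

/-- `Δ_k`: the number of pairs `(T, v)` where `T` is a triangle of `G` and `v` a vertex
of `T` of degree `k`. -/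
def clusterTriangles {n : ℕ} (k : ℕ) (G : SimpleGraph (Fin n)) : ℕ :=
  letI := Classical.decRel G.Adj
  ∑ t ∈ G.cliqueFinset 3, (t.filter fun v => degreeOf G v = k).card

/-- The local clustering coefficient `c(k) = 2Δ_k/(N_k k(k-1))`. -/
def localCluster {n : ℕ} (d : Fin n → ℕ) (k : ℕ) (G : SimpleGraph (Fin n)) : ℝ :=
  2 * (clusterTriangles k G : ℝ) / ((Nk d k : ℝ) * k * ((k : ℝ) - 1))


/-- The neighbourhood of `v` in `G` as a finset. -/
def nbrFinset {n : ℕ} (G : SimpleGraph (Fin n)) (v : Fin n) : Finset (Fin n) :=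
  letI := Classical.decRel G.Adj
  G.neighborFinset v


lemma tp_step (s : ℝ) (hs : 0 < s) (i : ℕ) (hi : 1 ≤ i) :
    s * ((i + 1 : ℕ) : ℝ) ^ (-s - 1) ≤ (i : ℝ) ^ (-s) - ((i + 1 : ℕ) : ℝ) ^ (-s) := by
  have hi0 : (0:ℝ) < i := by exact_mod_cast hi
  have hx : (0:ℝ) < (i:ℝ) + 1 := by linarith
  push_cast
  have h1 : ((i:ℝ) + 1) ^ (-s - 1) = ((i:ℝ) + 1) ^ (-s) / ((i:ℝ)+1) := by
    rw [Real.rpow_sub hx, Real.rpow_one]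
  have h2 : (i:ℝ) ^ (-s) = ((i:ℝ) + 1) ^ (-s) * Real.exp (s * Real.log (((i:ℝ)+1)/i)) := by
    rw [Real.rpow_def_of_pos hi0, Real.rpow_def_of_pos hx, ← Real.exp_add,
      Real.log_div hx.ne' hi0.ne']
    congr 1
    ring
  have h3 : 1 / ((i:ℝ)+1) ≤ Real.log (((i:ℝ)+1)/i) := by
    have := Real.one_sub_inv_le_log_of_pos (x := ((i:ℝ)+1)/i) (by positivity)
    refine le_trans (le_of_eq ?_) this
    field_simp
    ring
  have h4 := Real.add_one_le_exp (s * Real.log (((i:ℝ)+1)/i))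
  have h5 : s * (1 / ((i:ℝ)+1)) ≤ s * Real.log (((i:ℝ)+1)/i) :=
    mul_le_mul_of_nonneg_left h3 hs.le
  have h6 : (0:ℝ) < ((i:ℝ) + 1) ^ (-s) := Real.rpow_pos_of_pos hx _
  rw [h1, h2]
  have h7 : ((i:ℝ) + 1) ^ (-s) * (s * (1 / ((i:ℝ)+1)) + 1) ≤
      ((i:ℝ) + 1) ^ (-s) * Real.exp (s * Real.log (((i:ℝ)+1)/i)) :=
    mul_le_mul_of_nonneg_left (by linarith) h6.le
  have h8 : s * (((i:ℝ) + 1) ^ (-s) / ((i:ℝ)+1)) =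
    ((i:ℝ) + 1) ^ (-s) * (s * (1 / ((i:ℝ)+1)) + 1) - ((i:ℝ) + 1) ^ (-s) := by ring
  rw [h8]
  linarith

lemma tp_tail (s : ℝ) (hs : 0 < s) (m : ℕ) (hm : 1 ≤ m) (M : ℕ) :
    ∑ i ∈ Finset.Ico m M, ((i + 1 : ℕ) : ℝ) ^ (-s - 1) ≤ (m : ℝ) ^ (-s) / s := by
  rw [le_div_iff₀ hs, mul_comm, Finset.mul_sum]
  have hpos : ∀ k : ℕ, (0:ℝ) ≤ (k:ℝ) ^ (-s) := fun k => by positivity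
  rcases le_or_gt M m with h | h
  · rw [Finset.Ico_eq_empty_of_le h]; simpa using hpos m
  · calc _ ≤ ∑ i ∈ Finset.Ico m M, ((i : ℝ) ^ (-s) - ((i + 1 : ℕ) : ℝ) ^ (-s)) :=
          Finset.sum_le_sum fun i hi => tp_step s hs i (hm.trans (Finset.mem_Ico.1 hi).1)
      _ = (m:ℝ) ^ (-s) - (M:ℝ) ^ (-s) := by
          have := Finset.sum_Ico_sub (fun i : ℕ => -((i:ℝ) ^ (-s))) h.le
          simp only [neg_sub_neg] at this
          rw [this]
      _ ≤ _ := by linarith [hpos M]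

lemma tp_count {n : ℕ} (hn : 0 < n) (τ K : ℝ) (hK : 0 < K) (d : Fin n → ℕ)
    (h : ∀ j : ℕ, 1 ≤ j → j ≤ dmax n d → 1 - Fn n d j ≤ K * (j : ℝ) ^ (1 - τ))
    (j : ℕ) (hj : 1 ≤ j) :
    ((Finset.univ.filter fun i => j < d i).card : ℝ) ≤ n * K * (j : ℝ) ^ (1 - τ) := by
  have hn' : (0:ℝ) < n := by exact_mod_cast hn
  rcases le_or_gt j (dmax n d) with hd | hd
  · have h1 := h j hj hd
    have h2 : (Nat.card {i : Fin n // d i ≤ j} : ℝ) +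
        ((Finset.univ.filter fun i => j < d i).card : ℝ) = n := by
      rw [Nat.card_eq_fintype_card, Fintype.card_subtype]
      have := Finset.card_filter_add_card_filter_not (s := (Finset.univ : Finset (Fin n)))
        (fun i => d i ≤ j)
      simp only [not_le, Finset.card_univ, Fintype.card_fin] at this
      exact_mod_cast this
    unfold Fn at h1
    have h3 : 1 - (Nat.card {i : Fin n // d i ≤ j} : ℝ) / n =
        ((Finset.univ.filter fun i => j < d i).card : ℝ) / n := by
      field_simp; linarith
    rw [h3, div_le_iff₀ hn'] at h1
    linarith
  · have : (Finset.univ.filter fun i => j < d i) = ∅ := by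
      apply Finset.filter_eq_empty_iff.2
      intro i _ hi
      have : d i ≤ dmax n d := Finset.le_sup (f := d) (Finset.mem_univ i)
      omega
    rw [this]
    simp only [Finset.card_empty, Nat.cast_zero]
    positivity

lemma tp_layer (D m n : ℕ) (hD : D ≤ n) :
    (D : ℝ) ≤ (m + 1 : ℝ) + ∑ i ∈ Finset.Ico m n, (if i + 1 < D then (1:ℝ) else 0) := by
  rw [Finset.sum_ite, Finset.sum_const_zero, add_zero, Finset.sum_const, nsmul_eq_mul, mul_one]
  have : (Finset.Ico m n).filter (fun i => i + 1 < D) = Finset.Ico m (D - 1) := by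
    ext i; simp only [Finset.mem_filter, Finset.mem_Ico]; omega
  rw [this, Nat.card_Ico]
  have : D ≤ m + 1 + (D - 1 - m) := by omega
  exact_mod_cast this

lemma tp_sum {n : ℕ} (hn : 0 < n) (τ K : ℝ) (hτ : 2 < τ) (hK : 0 < K) (d : Fin n → ℕ)
    (hdn : ∀ i, d i ≤ n)
    (h : ∀ j : ℕ, 1 ≤ j → j ≤ dmax n d → 1 - Fn n d j ≤ K * (j : ℝ) ^ (1 - τ))
    (S : Finset (Fin n)) (m : ℕ) (hm : 1 ≤ m) :
    ∑ u ∈ S, (d u : ℝ) ≤ S.card * (m + 1 : ℝ) + n * K * ((m:ℝ) ^ (-(τ - 2)) / (τ - 2)) := by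
  calc ∑ u ∈ S, (d u : ℝ)
      ≤ ∑ u ∈ S, ((m + 1 : ℝ) + ∑ i ∈ Finset.Ico m n, (if i + 1 < d u then (1:ℝ) else 0)) :=
        Finset.sum_le_sum fun u _ => tp_layer _ _ _ (hdn u)
    _ = S.card * (m + 1 : ℝ) +
        ∑ i ∈ Finset.Ico m n, ∑ u ∈ S, (if i + 1 < d u then (1:ℝ) else 0) := by
        rw [Finset.sum_add_distrib, Finset.sum_const, nsmul_eq_mul, Finset.sum_comm]
    _ ≤ S.card * (m + 1 : ℝ) +
        ∑ i ∈ Finset.Ico m n, n * K * ((i + 1 : ℕ) : ℝ) ^ (-(τ - 2) - 1) := by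
        gcongr with i hi
        have := tp_count hn τ K hK d h (i+1) (by omega)
        have e : -(τ - 2) - 1 = 1 - τ := by ring
        rw [e]
        refine le_trans ?_ this
        rw [Finset.card_filter]
        push_cast
        exact Finset.sum_le_sum_of_subset_of_nonneg (Finset.subset_univ S)
          (fun u _ _ => by split_ifs <;> norm_num)
    _ ≤ _ := by
        rw [← Finset.mul_sum]
        have := tp_tail (τ - 2) (by linarith) m hm n
        gcongr

lemma tp_deg {n : ℕ} (hn : 0 < n) (τ K : ℝ) (hτ : 2 < τ) (hK : 0 < K) (d : Fin n → ℕ)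
    (h : ∀ j : ℕ, 1 ≤ j → j ≤ dmax n d → 1 - Fn n d j ≤ K * (j : ℝ) ^ (1 - τ))
    (v : Fin n) :
    (d v : ℝ) ≤ (1 + 2 * K ^ (1 / (τ - 1))) * (n:ℝ) ^ (1 / (τ - 1)) := by
  have hn1 : (1:ℝ) ≤ n := by exact_mod_cast hn
  have ht : 0 < τ - 1 := by linarith
  have hX : 1 ≤ (n:ℝ) ^ (1 / (τ - 1)) := Real.one_le_rpow hn1 (by positivity)
  have hKp : 0 < K ^ (1 / (τ - 1)) := Real.rpow_pos_of_pos hK _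
  rcases Nat.lt_or_ge (d v) 2 with h2 | h2
  · have : (d v : ℝ) ≤ 1 := by exact_mod_cast (by omega : d v ≤ 1)
    nlinarith [mul_pos hKp (by linarith : 0 < (n:ℝ) ^ (1 / (τ - 1)))]
  · obtain ⟨j, hj⟩ : ∃ j, d v = j + 1 := ⟨d v - 1, by omega⟩
    have hj1 : 1 ≤ j := by omega
    have hj1' : (1:ℝ) ≤ j := by exact_mod_cast hj1
    have hj0 : (0:ℝ) < j := by linarith
    have hc := tp_count hn τ K hK d h j hj1
    have h1 : (1:ℝ) ≤ ((Finset.univ.filter fun i => j < d i).card : ℝ) := by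
      exact_mod_cast Finset.card_pos.2 ⟨v, by simp [hj]⟩
    have h3 : (j:ℝ) ^ (τ - 1) ≤ n * K := by
      have e : (j:ℝ) ^ (1 - τ) = ((j:ℝ) ^ (τ - 1))⁻¹ := by
        rw [← Real.rpow_neg hj0.le]; congr 1; ring
      rw [e] at hc
      have hp : 0 < (j:ℝ) ^ (τ - 1) := Real.rpow_pos_of_pos hj0 _
      have := h1.trans hc
      rw [← div_eq_mul_inv, le_div_iff₀ hp] at this
      linarith
    have h4 : (j:ℝ) ≤ (n:ℝ) ^ (1 / (τ - 1)) * K ^ (1 / (τ - 1)) := by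
      rw [← Real.mul_rpow (by linarith) hK.le]
      calc (j:ℝ) = ((j:ℝ) ^ (τ - 1)) ^ (1 / (τ - 1)) := by
            rw [← Real.rpow_mul hj0.le, mul_one_div_cancel ht.ne', Real.rpow_one]
        _ ≤ _ := Real.rpow_le_rpow (by positivity) h3 (by positivity)
    rw [hj]
    push_cast
    linarith

/-- **Lemma 2** (2-paths): there is a constant `C'`, depending only on `τ` and `K`, such
that for every simple graph whose degree sequence obeys the power-law tail bound, the sum
of degrees over the neighbours of any vertex (hence the number of 2-paths from that
vertex) is at most `C' n^{(2τ-3)/(τ-1)²}`; moreover `(2τ-3)/(τ-1)² < 1`. -/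
theorem two_paths_bound
    (τ K : ℝ) (hτ : τ ∈ Set.Ioo (2:ℝ) 3) (hK : 0 < K) :
    (∃ C' : ℝ, 0 < C' ∧
      ∀ (n : ℕ) (G : SimpleGraph (Fin n)),
        (∀ j : ℕ, 1 ≤ j → j ≤ dmax n (fun i => degreeOf G i) →
          1 - Fn n (fun i => degreeOf G i) j ≤ K * (j : ℝ) ^ (1 - τ)) →
        ∀ v : Fin n,
          (∑ u ∈ nbrFinset G v, (degreeOf G u : ℝ)) ≤
            C' * (n : ℝ) ^ ((2*τ - 3)/(τ - 1)^2)) ∧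
    (2*τ - 3)/(τ - 1)^2 < 1 := by
  obtain ⟨h2, h3⟩ := hτ
  have ht : 0 < τ - 1 := by linarith
  have hs : 0 < τ - 2 := by linarith
  refine ⟨⟨3 * (1 + 2 * K ^ (1 / (τ - 1))) + K / (τ - 2), by positivity, ?_⟩, ?_⟩
  · intro n G h v
    have hn : 0 < n := v.pos
    have hn1 : (1:ℝ) ≤ n := by exact_mod_cast hn
    have hn0 : (0:ℝ) < n := by linarith
    have hcard : (nbrFinset G v).card = degreeOf G v := rfl
    have hdn : ∀ i, degreeOf G i ≤ n := fun i => by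
      have := Finset.card_le_univ (nbrFinset G i)
      rw [Fintype.card_fin] at this
      exact this
    set β := (τ - 2) / (τ - 1)^2 with hβ
    have hT : 1 ≤ (n:ℝ) ^ β := Real.one_le_rpow hn1 (by positivity)
    set m := ⌈(n:ℝ) ^ β⌉₊ with hmdef
    have hm : 1 ≤ m := Nat.one_le_ceil_iff.2 (by linarith)
    have hm1 : (n:ℝ) ^ β ≤ m := Nat.le_ceil _
    have hm2 : (m:ℝ) < (n:ℝ) ^ β + 1 := Nat.ceil_lt_add_one (by linarith)
    have hsum := tp_sum hn τ K h2 hK (fun i => degreeOf G i) hdn h (nbrFinset G v) m hm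
    have hdeg := tp_deg hn τ K h2 hK (fun i => degreeOf G i) h v
    rw [hcard] at hsum
    refine hsum.trans ?_
    rw [add_mul]
    apply add_le_add
    · calc (degreeOf G v : ℝ) * (m + 1 : ℝ)
          ≤ ((1 + 2 * K ^ (1 / (τ - 1))) * (n:ℝ) ^ (1 / (τ - 1))) * (3 * (n:ℝ) ^ β) := by
            apply mul_le_mul hdeg (by linarith) (by positivity) (by positivity)
        _ = 3 * (1 + 2 * K ^ (1 / (τ - 1))) * ((n:ℝ) ^ (1 / (τ - 1)) * (n:ℝ) ^ β) := by ring
        _ = _ := by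
            rw [← Real.rpow_add hn0]
            congr 2
            rw [hβ]; field_simp; ring
    · calc (n:ℝ) * K * ((m:ℝ) ^ (-(τ - 2)) / (τ - 2))
          ≤ (n:ℝ) * K * (((n:ℝ) ^ β) ^ (-(τ - 2)) / (τ - 2)) := by
            have := Real.rpow_le_rpow_of_nonpos (by linarith) hm1 (by linarith : -(τ - 2) ≤ 0)
            gcongr
        _ = K / (τ - 2) * ((n:ℝ) ^ (1:ℝ) * (n:ℝ) ^ (β * (-(τ - 2)))) := by
            rw [Real.rpow_mul hn0.le, Real.rpow_one]; ring
        _ = _ := by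
            rw [← Real.rpow_add hn0]
            congr 2
            rw [hβ]; field_simp; ring
  · rw [div_lt_one (by positivity)]
    nlinarith

end
end

section
/- For every τ ∈ (2,3), the triple integral ∫₀^∞∫₀^∞∫₀^∞ (xyz)^{−τ} · (xy/(1+xy)) · (xz/(1+xz)) · (yz/(1+yz)) dx dy dz is finite. -/
open MeasureTheory Real
open scoped ENNReal

lemma aux_frac (a : ℝ) : exp a / (1 + exp a) ≤ exp (a/2 - |a|/2) := by
  have h := exp_pos a
  rw [div_le_iff₀ (by positivity)]
  rcases le_total 0 a with h0 | h0
  · rw [abs_of_nonneg h0]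
    simp
  · rw [abs_of_nonpos h0]
    have : a/2 - -a/2 = a := by ring
    rw [this]
    nlinarith

lemma aux_lin (τ s t r : ℝ) (h2 : 2 < τ) (h3 : τ < 3) :
    -τ * (s+t+r) + ((s+t)/2 - |s+t|/2) + ((s+r)/2 - |s+r|/2) + ((t+r)/2 - |t+r|/2)
     ≤ (-s - (3-τ)/3*|s|) + (-t - (3-τ)/3*|t|) + (-r - (3-τ)/3*|r|) := by
  obtain ⟨A, hA⟩ : ∃ A, A = (|s+t| + |s+r| + |t+r|)/2 := ⟨_, rfl⟩
  have h1 : -(s+t+r) ≤ A := by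
    rw [hA]; linarith [neg_abs_le (s+t), neg_abs_le (s+r), neg_abs_le (t+r)]
  have hb : |s| + |t| + |r| ≤ 3 * A := by
    have e1 := abs_le.1 (le_refl |s+t|)
    have e2 := abs_le.1 (le_refl |s+r|)
    have e3 := abs_le.1 (le_refl |t+r|)
    have : |s| ≤ A := by rw [abs_le]; constructor <;> linarith [e1.1, e1.2, e2.1, e2.2, e3.1, e3.2]
    have : |t| ≤ A := by rw [abs_le]; constructor <;> linarith [e1.1, e1.2, e2.1, e2.2, e3.1, e3.2]
    have : |r| ≤ A := by rw [abs_le]; constructor <;> linarith [e1.1, e1.2, e2.1, e2.2, e3.1, e3.2]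
    linarith
  have k1 := mul_le_mul_of_nonneg_left h1 (by linarith : 0 ≤ τ - 2)
  have k2 := mul_le_mul_of_nonneg_left hb (by linarith : 0 ≤ (3-τ)/3)
  nlinarith

lemma aux_pt (τ x y z : ℝ) (h2 : 2 < τ) (h3 : τ < 3) (hx : 0 < x) (hy : 0 < y) (hz : 0 < z) :
    (x*y*z) ^ (-τ) * (x*y/(1+x*y)) * (x*z/(1+x*z)) * (y*z/(1+y*z)) ≤
      exp (-log x - (3-τ)/3*|log x|) * (exp (-log y - (3-τ)/3*|log y|) *
        exp (-log z - (3-τ)/3*|log z|)) := by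
  obtain ⟨s, rfl⟩ : ∃ s, x = exp s := ⟨log x, (exp_log hx).symm⟩
  obtain ⟨t, rfl⟩ : ∃ s, y = exp s := ⟨log y, (exp_log hy).symm⟩
  obtain ⟨r, rfl⟩ : ∃ s, z = exp s := ⟨log z, (exp_log hz).symm⟩
  simp only [log_exp, ← exp_add, ← exp_mul]
  have b1 := aux_frac (s+t)
  have b2 := aux_frac (s+r)
  have b3 := aux_frac (t+r)
  calc _ ≤ exp ((s+t+r) * -τ) * exp ((s+t)/2 - |s+t|/2) * exp ((s+r)/2 - |s+r|/2)
        * exp ((t+r)/2 - |t+r|/2) := by gcongr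
    _ ≤ _ := by
      simp only [← exp_add]
      apply exp_le_exp.2
      linarith [aux_lin τ s t r h2 h3]

lemma aux_int (δ : ℝ) (hδ : 0 < δ) :
    ∫⁻ x in Set.Ioi (0:ℝ), ENNReal.ofReal (exp (-log x - δ*|log x|)) < ⊤ := by
  have key : IntegrableOn (fun x : ℝ => exp (-log x - δ*|log x|)) (Set.Ioi 0) := by
    rw [← Set.Ioc_union_Ioi_eq_Ioi (zero_le_one (α := ℝ))]
    refine IntegrableOn.union ?_ ?_
    · have h : IntegrableOn (fun x : ℝ => x ^ (δ-1)) (Set.Ioc 0 1) := by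
        rw [← intervalIntegrable_iff_integrableOn_Ioc_of_le zero_le_one]
        exact intervalIntegral.intervalIntegrable_rpow' (by linarith)
      refine h.congr_fun (fun x hx => ?_) measurableSet_Ioc
      simp only
      rw [rpow_def_of_pos hx.1, abs_of_nonpos (log_nonpos hx.1.le hx.2)]
      congr 1; ring
    · have h := integrableOn_Ioi_rpow_of_lt (by linarith : -1-δ < -1) zero_lt_one
      refine h.congr_fun (fun x hx => ?_) measurableSet_Ioi
      have hx : 1 < x := hx
      simp only
      rw [rpow_def_of_pos (by linarith), abs_of_nonneg (log_nonneg hx.le)]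
      congr 1; ring
  exact key.lintegral_lt_top

/-- For every `τ ∈ (2,3)` the triple integral
`∫₀^∞∫₀^∞∫₀^∞ (xyz)^{-τ} (xy/(1+xy))(xz/(1+xz))(yz/(1+yz)) dx dy dz` is finite. -/
theorem triple_integral_finite (τ : ℝ) (hτ : τ ∈ Set.Ioo (2:ℝ) 3) :
    (∫⁻ x in Set.Ioi (0:ℝ), ∫⁻ y in Set.Ioi (0:ℝ), ∫⁻ z in Set.Ioi (0:ℝ),
      ENNReal.ofReal ((x*y*z) ^ (-τ) *
        (x*y/(1+x*y)) * (x*z/(1+x*z)) * (y*z/(1+y*z)))) < ⊤ := by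
  obtain ⟨h2, h3⟩ := hτ
  have hC := aux_int ((3-τ)/3) (by linarith)
  set k : ℝ → ℝ≥0∞ := fun x => ENNReal.ofReal (exp (-log x - (3-τ)/3*|log x|)) with hk
  have hm : Measurable k := by rw [hk]; fun_prop
  calc _ ≤ ∫⁻ x in Set.Ioi (0:ℝ), ∫⁻ y in Set.Ioi (0:ℝ), ∫⁻ z in Set.Ioi (0:ℝ),
        k x * (k y * k z) := by
        refine setLIntegral_mono' measurableSet_Ioi fun x hx => ?_
        refine setLIntegral_mono' measurableSet_Ioi fun y hy => ?_
        refine setLIntegral_mono' measurableSet_Ioi fun z hz => ?_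
        simp only [hk]
        rw [← ENNReal.ofReal_mul (exp_pos _).le, ← ENNReal.ofReal_mul (exp_pos _).le]
        exact ENNReal.ofReal_le_ofReal (aux_pt τ x y z h2 h3 hx hy hz)
    _ = (∫⁻ x in Set.Ioi (0:ℝ), k x) *
        ((∫⁻ x in Set.Ioi (0:ℝ), k x) * (∫⁻ x in Set.Ioi (0:ℝ), k x)) := by
        have e1 : ∀ x y, ∫⁻ z in Set.Ioi (0:ℝ), k x * (k y * k z) =
            k x * (k y * ∫⁻ z in Set.Ioi (0:ℝ), k z) := fun x y => by
          rw [lintegral_const_mul _ (hm.const_mul _), lintegral_const_mul _ hm]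
        simp only [e1]
        have e2 : ∀ x, ∫⁻ y in Set.Ioi (0:ℝ), k x * (k y * ∫⁻ z in Set.Ioi (0:ℝ), k z) =
            k x * ((∫⁻ z in Set.Ioi (0:ℝ), k z) * ∫⁻ z in Set.Ioi (0:ℝ), k z) := fun x => by
          rw [lintegral_const_mul _ (hm.mul_const _), lintegral_mul_const _ hm]
        simp only [e2]
        rw [lintegral_mul_const _ hm]
    _ < ⊤ := ENNReal.mul_lt_top hC (ENNReal.mul_lt_top hC hC)
end

section
/- For every τ ∈ (2,3), ∫₀^∞∫₀^∞∫₀^∞ (xyz)^{−τ}·(xy/(1+xy))·(xz/(1+xz))·(yz/(1+yz)) dx dy dz < ∫₀^∞∫₀^∞∫₀^∞ (xyz)^{−τ}·(1−e^{−xy})·(1−e^{−xz})·(1−e^{−yz}) dx dy dz, and both triple integrals are finite. (Consequently the leading constant for the triangle count in the uniform random graph is strictly smaller than that of the erased configuration model.) -/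
open MeasureTheory Real
open scoped ENNReal

lemma ule_scale (f : ℝ → ℝ≥0∞) (c : ℝ) (hc : 0 < c) :
    ∫⁻ y in Set.Ioi (0:ℝ), f y = ∫⁻ y in Set.Ioi (0:ℝ), ENNReal.ofReal c * f (c * y) := by
  have h := lintegral_image_eq_lintegral_abs_deriv_mul (s := Set.Ioi (0:ℝ))
    (f := fun y => c * y) (f' := fun _ => c) measurableSet_Ioi
    (fun x _ => by simpa using ((hasDerivAt_id x).const_mul c).hasDerivWithinAt)
    (fun a _ b _ hab => mul_left_cancel₀ hc.ne' hab) f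
  have himg : (fun y => c * y) '' Set.Ioi (0:ℝ) = Set.Ioi 0 := by
    ext y
    constructor
    · rintro ⟨x, hx, rfl⟩
      exact mul_pos hc hx
    · intro hy
      exact ⟨y / c, div_pos hy hc, by field_simp⟩
  rw [himg, abs_of_pos hc] at h
  exact h

lemma ule_fin (h : ℝ → ℝ) (a b : ℝ) (ha : -1 < a) (hb : b < -1)
    (h1 : ∀ t, 0 < t → t ≤ 1 → h t ≤ t ^ a) (h2 : ∀ t, 1 < t → h t ≤ t ^ b) :
    ∫⁻ t in Set.Ioi (0:ℝ), ENNReal.ofReal (h t) < ⊤ := by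
  rw [← Set.Ioc_union_Ioi_eq_Ioi (zero_le_one' ℝ)]
  refine (lintegral_union_le _ _ _).trans_lt (ENNReal.add_lt_top.2 ⟨?_, ?_⟩)
  · refine (setLIntegral_mono' measurableSet_Ioc
      (fun t ht => ENNReal.ofReal_le_ofReal (h1 t ht.1 ht.2))).trans_lt ?_
    exact IntegrableOn.setLIntegral_lt_top
      ((intervalIntegrable_iff_integrableOn_Ioc_of_le zero_le_one).1
        (intervalIntegral.intervalIntegrable_rpow' ha))
  · refine (setLIntegral_mono' measurableSet_Ioi
      (fun t ht => ENNReal.ofReal_le_ofReal (h2 t ht))).trans_lt ?_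
    exact IntegrableOn.setLIntegral_lt_top (integrableOn_Ioi_rpow_of_lt hb zero_lt_one)

lemma ule_alg1 (τ x u v : ℝ) (hx : 0 < x) (hu : 0 < u) (hv : 0 < v) :
    x⁻¹ * (x⁻¹ * ((x*(x⁻¹*u)*(x⁻¹*v)) ^ (-τ) * min 1 (x*(x⁻¹*u)) * min 1 (x*(x⁻¹*v))
      * min 1 ((x⁻¹*u)*(x⁻¹*v)))) =
    (u*v)^(-τ) * min 1 u * min 1 v * x^(τ-2) * min 1 (u*v/x^2) := by
  have e1 : x*(x⁻¹*u) = u := by field_simp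
  have e2 : x*(x⁻¹*v) = v := by field_simp
  have e3 : (x⁻¹*u)*(x⁻¹*v) = u*v/x^2 := by field_simp
  have e4 : u*(x⁻¹*v) = (u*v)*x⁻¹ := by ring
  have e5 : x ^ (τ-2) = x^τ * x⁻¹ * x⁻¹ := by
    rw [Real.rpow_sub hx]; norm_num; field_simp
  rw [e1, e2, e3, e4, Real.mul_rpow (by positivity) (by positivity), e5,
    Real.inv_rpow hx.le, Real.rpow_neg hx.le, inv_inv]
  ring

lemma ule_alg2 (τ t u v : ℝ) (ht : 0 < t) (hu : 0 < u) (hv : 0 < v) :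
    √(u*v) * ((u*v)^(-τ) * min 1 u * min 1 v * (√(u*v)*t)^(τ-2) * min 1 (u*v/(√(u*v)*t)^2)) =
    (u^(-(τ+1)/2) * min 1 u) * ((v^(-(τ+1)/2) * min 1 v) * (t^(τ-2) * min 1 (1/t^2))) := by
  have huv : 0 < u*v := mul_pos hu hv
  have e1 : u*v/(√(u*v)*t)^2 = 1/t^2 := by
    rw [mul_pow, Real.sq_sqrt huv.le]; field_simp
  have e2 : √(u*v) * ((u*v)^(-τ) * √(u*v)^(τ-2)) = u^(-(τ+1)/2) * v^(-(τ+1)/2) := by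
    rw [Real.sqrt_eq_rpow, ← Real.rpow_mul huv.le, ← Real.rpow_add huv, ← Real.rpow_add huv,
      ← Real.mul_rpow hu.le hv.le]
    congr 1; ring
  rw [e1, Real.mul_rpow (by positivity) ht.le]
  linear_combination (min 1 u * min 1 v * t^(τ-2) * min 1 (1/t^2)) * e2

lemma ule_finite (τ : ℝ) (hτ : τ ∈ Set.Ioo (2:ℝ) 3) :
    (∫⁻ x in Set.Ioi (0:ℝ), ∫⁻ y in Set.Ioi (0:ℝ), ∫⁻ z in Set.Ioi (0:ℝ),
        ENNReal.ofReal ((x*y*z) ^ (-τ) * min 1 (x*y) * min 1 (x*z) * min 1 (y*z))) < ⊤ := by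
  obtain ⟨h2, h3⟩ := hτ
  have hK : ∫⁻ u in Set.Ioi (0:ℝ), ENNReal.ofReal (u^(-(τ+1)/2) * min 1 u) < ⊤ := by
    refine ule_fin _ (-(τ+1)/2 + 1) (-(τ+1)/2) (by linarith) (by linarith) ?_ ?_
    · intro t ht _
      rw [Real.rpow_add ht, Real.rpow_one]
      exact mul_le_mul_of_nonneg_left (min_le_right _ _) (by positivity)
    · intro t ht
      exact mul_le_of_le_one_right (by positivity) (min_le_left _ _)
  have hJ : ∫⁻ t in Set.Ioi (0:ℝ), ENNReal.ofReal (t^(τ-2) * min 1 (1/t^2)) < ⊤ := by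
    refine ule_fin _ (τ-2) (τ-2-2) (by linarith) (by linarith) ?_ ?_
    · intro t ht _
      exact mul_le_of_le_one_right (by positivity) (min_le_left _ _)
    · intro t ht
      have ht : 0 < t := by linarith
      rw [Real.rpow_sub ht (τ-2) 2, Real.rpow_two, div_eq_mul_one_div (t^(τ-2))]
      exact mul_le_mul_of_nonneg_left (min_le_right _ _) (by positivity)
  set g : ℝ → ℝ → ℝ → ℝ := fun x u v =>
    (u*v)^(-τ) * min 1 u * min 1 v * x^(τ-2) * min 1 (u*v/x^2) with hg
  have step1 : (∫⁻ x in Set.Ioi (0:ℝ), ∫⁻ y in Set.Ioi (0:ℝ), ∫⁻ z in Set.Ioi (0:ℝ),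
        ENNReal.ofReal ((x*y*z) ^ (-τ) * min 1 (x*y) * min 1 (x*z) * min 1 (y*z))) =
      ∫⁻ x in Set.Ioi (0:ℝ), ∫⁻ u in Set.Ioi (0:ℝ), ∫⁻ v in Set.Ioi (0:ℝ),
        ENNReal.ofReal (g x u v) := by
    refine setLIntegral_congr_fun measurableSet_Ioi fun x hx => ?_
    have hx : 0 < x := hx
    have hx' : 0 < x⁻¹ := inv_pos.2 hx
    beta_reduce
    rw [ule_scale _ x⁻¹ hx']
    refine setLIntegral_congr_fun measurableSet_Ioi fun u hu => ?_
    beta_reduce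
    rw [ule_scale _ x⁻¹ hx', ← lintegral_const_mul' _ _ ENNReal.ofReal_ne_top]
    refine setLIntegral_congr_fun measurableSet_Ioi fun v hv => ?_
    beta_reduce
    rw [← ENNReal.ofReal_mul hx'.le, ← ENNReal.ofReal_mul hx'.le, ule_alg1 τ x u v hx hu hv]
  have hgm : Measurable fun p : (ℝ × ℝ) × ℝ => ENNReal.ofReal (g p.1.1 p.1.2 p.2) := by
    simp only [hg]; fun_prop
  have step2 : ∫⁻ x in Set.Ioi (0:ℝ), ∫⁻ u in Set.Ioi (0:ℝ), ∫⁻ v in Set.Ioi (0:ℝ),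
        ENNReal.ofReal (g x u v) =
      ∫⁻ u in Set.Ioi (0:ℝ), ∫⁻ v in Set.Ioi (0:ℝ), ∫⁻ x in Set.Ioi (0:ℝ),
        ENNReal.ofReal (g x u v) := by
    rw [lintegral_lintegral_swap]
    · refine lintegral_congr fun u => ?_
      rw [lintegral_lintegral_swap]
      have : Measurable fun p : ℝ × ℝ => ENNReal.ofReal (g p.1 u p.2) := by
        simp only [hg]; fun_prop
      exact this.aemeasurable
    · exact (Measurable.lintegral_prod_right' hgm).aemeasurable
  have step3 : ∫⁻ u in Set.Ioi (0:ℝ), ∫⁻ v in Set.Ioi (0:ℝ), ∫⁻ x in Set.Ioi (0:ℝ),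
        ENNReal.ofReal (g x u v) =
      ∫⁻ u in Set.Ioi (0:ℝ), ∫⁻ v in Set.Ioi (0:ℝ), 
        ENNReal.ofReal (u^(-(τ+1)/2) * min 1 u) * (ENNReal.ofReal (v^(-(τ+1)/2) * min 1 v) *
         ∫⁻ t in Set.Ioi (0:ℝ), ENNReal.ofReal (t^(τ-2) * min 1 (1/t^2))) := by
    refine setLIntegral_congr_fun measurableSet_Ioi fun u hu => ?_
    refine setLIntegral_congr_fun measurableSet_Ioi fun v hv => ?_
    have hu : 0 < u := hu
    have hv : 0 < v := hv
    beta_reduce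
    rw [ule_scale _ (√(u*v)) (Real.sqrt_pos.2 (mul_pos hu hv)),
      ← lintegral_const_mul' _ _ ENNReal.ofReal_ne_top,
      ← lintegral_const_mul' _ _ ENNReal.ofReal_ne_top]
    refine setLIntegral_congr_fun measurableSet_Ioi fun t ht => ?_
    have ht : 0 < t := ht
    beta_reduce
    rw [← ENNReal.ofReal_mul (by positivity), ← ENNReal.ofReal_mul (by positivity),
      ← ENNReal.ofReal_mul (by positivity), ← ule_alg2 τ t u v ht hu hv]
  rw [step1, step2, step3]
  simp_rw [lintegral_const_mul' _ _ ENNReal.ofReal_ne_top, lintegral_mul_const' _ _ hJ.ne]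
  rw [lintegral_mul_const' _ _ (ENNReal.mul_lt_top hK hJ).ne]
  exact ENNReal.mul_lt_top hK (ENNReal.mul_lt_top hK hJ)

lemma ule_strict (u : ℝ) (hu : 0 < u) : u/(1+u) < 1 - Real.exp (-u) := by
  have h := Real.add_one_lt_exp hu.ne'
  have h1 : Real.exp (-u) < 1/(1+u) := by
    rw [Real.exp_neg, ← one_div]
    exact one_div_lt_one_div_of_lt (by linarith) (by linarith)
  have h2 : u/(1+u) = 1 - 1/(1+u) := by field_simp; ring
  linarith

lemma ule_min (u : ℝ) : 1 - Real.exp (-u) ≤ min 1 u := by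
  have h := Real.add_one_le_exp (-u)
  have h' := Real.exp_pos (-u)
  exact le_min (by linarith) (by linarith)

lemma ule_pt (τ x y z : ℝ) (hx : 0 < x) (hy : 0 < y) (hz : 0 < z) :
    ENNReal.ofReal ((x*y*z) ^ (-τ) *
          (x*y/(1+x*y)) * (x*z/(1+x*z)) * (y*z/(1+y*z))) < 
    ENNReal.ofReal ((x*y*z) ^ (-τ) *
          (1 - Real.exp (-(x*y))) * (1 - Real.exp (-(x*z))) * (1 - Real.exp (-(y*z)))) := by
  have h1 := ule_strict (x*y) (by positivity)
  have h2 := ule_strict (x*z) (by positivity)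
  have h3 := ule_strict (y*z) (by positivity)
  have p1 : 0 < x*y/(1+x*y) := by positivity
  have p2 : 0 < x*z/(1+x*z) := by positivity
  have p3 : 0 < y*z/(1+y*z) := by positivity
  have q1 := p1.trans h1
  have q2 := p2.trans h2
  have q3 := p3.trans h3
  rw [ENNReal.ofReal_lt_ofReal_iff (by positivity)]
  gcongr

lemma ule_prod (f : ℝ → ℝ → ℝ → ℝ≥0∞)
    (hf : Measurable fun p : ℝ × ℝ × ℝ => f p.1 p.2.1 p.2.2) :
    (∫⁻ x in Set.Ioi (0:ℝ), ∫⁻ y in Set.Ioi (0:ℝ), ∫⁻ z in Set.Ioi (0:ℝ), f x y z) =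
    ∫⁻ p in Set.Ioi (0:ℝ) ×ˢ (Set.Ioi (0:ℝ) ×ˢ Set.Ioi (0:ℝ)), f p.1 p.2.1 p.2.2 := by
  rw [Measure.volume_eq_prod, Measure.volume_eq_prod, ← Measure.prod_restrict,
    ← Measure.prod_restrict, lintegral_prod _ hf.aemeasurable]
  refine lintegral_congr fun x => ?_
  rw [lintegral_prod _ (by fun_prop)]

/-- For every `τ ∈ (2,3)`, the triangle-count integral of the uniform random graph is
strictly smaller than that of the erased configuration model, and both are finite. -/
theorem uniform_less_than_erased (τ : ℝ) (hτ : τ ∈ Set.Ioo (2:ℝ) 3) :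
    (∫⁻ x in Set.Ioi (0:ℝ), ∫⁻ y in Set.Ioi (0:ℝ), ∫⁻ z in Set.Ioi (0:ℝ),
        ENNReal.ofReal ((x*y*z) ^ (-τ) *
          (x*y/(1+x*y)) * (x*z/(1+x*z)) * (y*z/(1+y*z)))) < ⊤ ∧
    (∫⁻ x in Set.Ioi (0:ℝ), ∫⁻ y in Set.Ioi (0:ℝ), ∫⁻ z in Set.Ioi (0:ℝ),
        ENNReal.ofReal ((x*y*z) ^ (-τ) *
          (1 - Real.exp (-(x*y))) * (1 - Real.exp (-(x*z))) * (1 - Real.exp (-(y*z))))) < ⊤ ∧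
    (∫⁻ x in Set.Ioi (0:ℝ), ∫⁻ y in Set.Ioi (0:ℝ), ∫⁻ z in Set.Ioi (0:ℝ),
        ENNReal.ofReal ((x*y*z) ^ (-τ) *
          (x*y/(1+x*y)) * (x*z/(1+x*z)) * (y*z/(1+y*z)))) <
      (∫⁻ x in Set.Ioi (0:ℝ), ∫⁻ y in Set.Ioi (0:ℝ), ∫⁻ z in Set.Ioi (0:ℝ),
        ENNReal.ofReal ((x*y*z) ^ (-τ) *
          (1 - Real.exp (-(x*y))) * (1 - Real.exp (-(x*z))) * (1 - Real.exp (-(y*z))))) := by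
  have hG : (∫⁻ x in Set.Ioi (0:ℝ), ∫⁻ y in Set.Ioi (0:ℝ), ∫⁻ z in Set.Ioi (0:ℝ),
        ENNReal.ofReal ((x*y*z) ^ (-τ) *
          (1 - Real.exp (-(x*y))) * (1 - Real.exp (-(x*z))) *
          (1 - Real.exp (-(y*z))))) < ⊤ := by
    refine lt_of_le_of_lt ?_ (ule_finite τ hτ)
    refine setLIntegral_mono' measurableSet_Ioi fun x hx => ?_
    refine setLIntegral_mono' measurableSet_Ioi fun y hy => ?_
    refine setLIntegral_mono' measurableSet_Ioi fun z hz => ENNReal.ofReal_le_ofReal ?_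
    have hx : 0 < x := hx
    have hy : 0 < y := hy
    have hz : 0 < z := hz
    have p : ∀ u : ℝ, 0 < u → 0 ≤ 1 - Real.exp (-u) := fun u hu =>
      (div_pos hu (by linarith)).le.trans (ule_strict u hu).le
    have p2 := p (x*z) (by positivity)
    have p3 := p (y*z) (by positivity)
    have m1 := ule_min (x*y)
    have m2 := ule_min (x*z)
    have m3 := ule_min (y*z)
    gcongr
  have hF := lt_of_le_of_lt (setLIntegral_mono' measurableSet_Ioi fun x hx =>
    setLIntegral_mono' measurableSet_Ioi fun y hy =>
    setLIntegral_mono' measurableSet_Ioi fun z hz => (ule_pt τ x y z hx hy hz).le) hG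
  refine ⟨hF, hG, ?_⟩
  rw [ule_prod _ (by fun_prop)] at hF ⊢
  rw [ule_prod _ (by fun_prop)]
  refine setLIntegral_strict_mono
    (measurableSet_Ioi.prod (measurableSet_Ioi.prod measurableSet_Ioi)) ?_ (by fun_prop) hF.ne ?_
  · rw [Measure.volume_eq_prod, Measure.volume_eq_prod, Measure.prod_prod, Measure.prod_prod]
    simp
  · exact Filter.Eventually.of_forall fun p hp => ule_pt τ _ _ _ hp.1 hp.2.1 hp.2.2
end
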